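/- Let n ≥ 2 and s, s' ∈ (0,n). Then there exist compact sets E, E' ⊆ ℝ^n with dimH E = s and dimH E' = s', and a quasiconformal homeomorphism f : ℝ^n → ℝ^n with f(E) = E'. -/

import Mathlib

open Set Filter MeasureTheory Metric Topology
open scoped ENNReal NNReal

noncomputable section

/-- The maximal stretch `L_f(x,r) = sup {dist (f y) (f x) : y ∈ Ω, dist y x = r}`. -/
def maxStretch {X Y : Type*} [MetricSpace X] [MetricSpace Y]
    (Ω : Set X) (f : X → Y) (x : X) (r : ℝ) : ℝ :=
  sSup ((fun y => dist (f y) (f x)) '' {y ∈ Ω | dist y x = r})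

/-- The minimal stretch `ℓ_f(x,r) = inf {dist (f y) (f x) : y ∈ Ω, dist y x = r}`. -/
def minStretch {X Y : Type*} [MetricSpace X] [MetricSpace Y]
    (Ω : Set X) (f : X → Y) (x : X) (r : ℝ) : ℝ :=
  sInf ((fun y => dist (f y) (f x)) '' {y ∈ Ω | dist y x = r})

/-- `f` is a homeomorphism of `Ω` onto `Ω'`. -/
def IsHomeoOn {X Y : Type*} [TopologicalSpace X] [TopologicalSpace Y]
    (f : X → Y) (Ω : Set X) (Ω' : Set Y) : Prop :=
  Set.BijOn f Ω Ω' ∧ ContinuousOn f Ω ∧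
    ∃ g : Y → X, Set.InvOn g f Ω Ω' ∧ ContinuousOn g Ω'

/-- `f : Ω → Ω'` is a `K`-quasiconformal homeomorphism:
it is a homeomorphism of `Ω` onto `Ω'` and
`limsup_{r → 0⁺} L_f(x,r)/ℓ_f(x,r) ≤ K` for every `x ∈ Ω`. -/
def IsQCHomeoOn {X Y : Type*} [MetricSpace X] [MetricSpace Y]
    (K : ℝ) (f : X → Y) (Ω : Set X) (Ω' : Set Y) : Prop :=
  IsHomeoOn f Ω Ω' ∧
    ∀ x ∈ Ω, Filter.limsup (fun r => maxStretch Ω f x r / minStretch Ω f x r)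
      (𝓝[>] (0:ℝ)) ≤ K

/-- A domain: a nonempty open connected set. -/
def IsEuclDomain {X : Type*} [TopologicalSpace X] (Ω : Set X) : Prop :=
  IsOpen Ω ∧ IsConnected Ω

/-- The increasing piecewise linear function with `0 ↦ 0`, `a ↦ b`, `R ↦ R` and slope `1`
beyond `R`. -/
def radialProfile (a b R t : ℝ) : ℝ :=
  b / a * min t a + (R - b) / (R - a) * max (min t R - a) 0 + max (t - R) 0

section Profile

variable {a b R s t : ℝ}

lemma radialProfile_of_le (haR : a < R) (ht : t ≤ a) : radialProfile a b R t = b / a * t := by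
  have h1 : min t R = t := min_eq_left (by linarith)
  rw [radialProfile, min_eq_left ht, h1, max_eq_right (by linarith), max_eq_right (by linarith)]
  ring

lemma radialProfile_of_mid (ha : 0 < a) (ht : a ≤ t) (htR : t ≤ R) :
    radialProfile a b R t = b + (R - b) / (R - a) * (t - a) := by
  rw [radialProfile, min_eq_right ht, min_eq_left htR, max_eq_left (by linarith),
    max_eq_right (by linarith), div_mul_cancel₀ _ ha.ne']
  ring

lemma radialProfile_of_ge (ha : 0 < a) (haR : a < R) (ht : R ≤ t) : radialProfile a b R t = t := by
  have h : R - a ≠ 0 := by linarith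
  rw [radialProfile, min_eq_right (by linarith), min_eq_right ht, max_eq_left (by linarith),
    max_eq_left (by linarith), div_mul_cancel₀ _ ha.ne', div_mul_cancel₀ _ h]
  ring

lemma radialProfile_nonneg (ha : 0 < a) (hb : 0 < b) (haR : a < R) (hbR : b < R) (ht : 0 ≤ t) :
    0 ≤ radialProfile a b R t := by
  have : 0 < R - a := by linarith
  have : 0 < R - b := by linarith
  have : 0 ≤ min t a := le_min ht ha.le
  unfold radialProfile
  positivity

lemma radialProfile_sub_le (ha : 0 < a) (hb : 0 < b) (haR : a < R) (hbR : b < R) (hst : s ≤ t) :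
    |radialProfile a b R t - radialProfile a b R s| ≤
      (b / a + (R - b) / (R - a) + 1) * (t - s) := by
  have hκ : 0 < (R - b) / (R - a) := div_pos (by linarith) (by linarith)
  have hba : 0 < b / a := div_pos hb ha
  have h1 : 0 ≤ min t a - min s a ∧ min t a - min s a ≤ t - s := by
    constructor <;> grind
  have h2 : 0 ≤ max (min t R - a) 0 - max (min s R - a) 0 ∧
      max (min t R - a) 0 - max (min s R - a) 0 ≤ t - s := by
    constructor <;> grind
  have h3 : 0 ≤ max (t - R) 0 - max (s - R) 0 ∧ max (t - R) 0 - max (s - R) 0 ≤ t - s := by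
    constructor <;> grind
  have e : radialProfile a b R t - radialProfile a b R s = b / a * (min t a - min s a) +
      (R - b) / (R - a) * (max (min t R - a) 0 - max (min s R - a) 0) +
      (max (t - R) 0 - max (s - R) 0) := by
    unfold radialProfile; ring
  have m1 := mul_nonneg hba.le h1.1
  have m2 := mul_nonneg hκ.le h2.1
  have n1 := mul_le_mul_of_nonneg_left h1.2 hba.le
  have n2 := mul_le_mul_of_nonneg_left h2.2 hκ.le
  rw [e, abs_of_nonneg (by linarith [h3.1])]
  linarith [h3.2]

lemma abs_radialProfile_sub_le (ha : 0 < a) (hb : 0 < b) (haR : a < R) (hbR : b < R) :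
    |radialProfile a b R s - radialProfile a b R t| ≤
      (b / a + (R - b) / (R - a) + 1) * |s - t| := by
  rcases le_total s t with h | h
  · rw [abs_sub_comm, abs_sub_comm s t, abs_of_nonneg (sub_nonneg.2 h)]
    exact radialProfile_sub_le ha hb haR hbR h
  · rw [abs_of_nonneg (sub_nonneg.2 h)]
    exact radialProfile_sub_le ha hb haR hbR h

lemma radialProfile_gt (haR : a < R) (hbR : b < R) (ha : 0 < a) (ht : a < t) :
    b < radialProfile a b R t := by
  rcases le_total t R with h | h
  · rw [radialProfile_of_mid ha ht.le h]
    have := mul_pos (div_pos (sub_pos.2 hbR) (sub_pos.2 haR)) (sub_pos.2 ht)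
    linarith
  · rw [radialProfile_of_ge ha haR h]
    linarith

lemma radialProfile_le (ha : 0 < a) (hb : 0 < b) (haR : a < R) (hbR : b < R) (ht : t ≤ R) :
    radialProfile a b R t ≤ R := by
  rcases le_total t a with h | h
  · rw [radialProfile_of_le haR h]
    have := mul_le_mul_of_nonneg_left h (div_pos hb ha).le
    rw [div_mul_cancel₀ _ ha.ne'] at this
    linarith
  · rw [radialProfile_of_mid ha h ht]
    have h0 : 0 < R - a := by linarith
    have := mul_le_mul_of_nonneg_left (sub_le_sub_right ht a) (div_pos (sub_pos.2 hbR) h0).le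
    rw [div_mul_cancel₀ _ h0.ne'] at this
    linarith

lemma radialProfile_radialProfile (ha : 0 < a) (hb : 0 < b) (haR : a < R) (hbR : b < R) :
    radialProfile b a R (radialProfile a b R t) = t := by
  have h0 : R - a ≠ 0 := by linarith
  have h1 : R - b ≠ 0 := by linarith
  rcases le_or_gt t a with h | h
  · have : b / a * t ≤ b := by
      have := mul_le_mul_of_nonneg_left h (div_pos hb ha).le
      rwa [div_mul_cancel₀ _ ha.ne'] at this
    rw [radialProfile_of_le haR h, radialProfile_of_le hbR this]
    field_simp
  · have hgt := radialProfile_gt haR hbR ha h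
    rcases le_total t R with h' | h'
    · have hle := radialProfile_le ha hb haR hbR h'
      rw [radialProfile_of_mid hb hgt.le hle, radialProfile_of_mid ha h.le h']
      field_simp
      ring
    · rw [radialProfile_of_ge ha haR h', radialProfile_of_ge hb hbR h']

end Profile

section Radial

variable {X : Type*} [NormedAddCommGroup X] [NormedSpace ℝ X] {a b R : ℝ}

/-- The radial map `x ↦ φ(‖x‖) x / ‖x‖` with profile `φ = radialProfile a b R`. -/
def radialMap (a b R : ℝ) (x : X) : X := (radialProfile a b R ‖x‖ / ‖x‖) • x

lemma norm_radialMap (ha : 0 < a) (hb : 0 < b) (haR : a < R) (hbR : b < R) (x : X) :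
    ‖radialMap a b R x‖ = radialProfile a b R ‖x‖ := by
  have h := radialProfile_nonneg ha hb haR hbR (norm_nonneg x)
  rw [radialMap, norm_smul, Real.norm_of_nonneg (div_nonneg h (norm_nonneg x))]
  rcases eq_or_ne x 0 with rfl | hx
  · simp [radialProfile_of_le haR ha.le]
  · rw [div_mul_cancel₀ _ (norm_ne_zero_iff.2 hx)]

lemma radialMap_of_le (haR : a < R) {x : X} (hx : ‖x‖ ≤ a) :
    radialMap a b R x = (b / a) • x := by
  rcases eq_or_ne x 0 with rfl | h
  · simp [radialMap]
  · rw [radialMap, radialProfile_of_le haR hx, mul_div_cancel_right₀ _ (norm_ne_zero_iff.2 h)]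

lemma radialMap_of_ge (ha : 0 < a) (haR : a < R) {x : X} (hx : R ≤ ‖x‖) :
    radialMap a b R x = x := by
  rw [radialMap, radialProfile_of_ge ha haR hx, div_self (by linarith), one_smul]

lemma radialMap_radialMap (ha : 0 < a) (hb : 0 < b) (haR : a < R) (hbR : b < R) (x : X) :
    radialMap b a R (radialMap a b R x) = x := by
  rcases eq_or_ne x 0 with rfl | hx
  · simp [radialMap]
  have hn := norm_ne_zero_iff.2 hx
  have key := radialProfile_radialProfile (t := ‖x‖) ha hb haR hbR
  have h0 : radialProfile a b R ‖x‖ ≠ 0 := by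
    intro h
    rw [h, radialProfile_of_le hbR hb.le, mul_zero] at key
    exact hn key.symm
  rw [radialMap, norm_radialMap ha hb haR hbR, key, radialMap, smul_smul,
    div_mul_div_cancel₀ h0, div_self hn, one_smul]

lemma norm_radialMap_sub_le (ha : 0 < a) (hb : 0 < b) (haR : a < R) (hbR : b < R) (x y : X) :
    ‖radialMap a b R x - radialMap a b R y‖ ≤
      3 * (b / a + (R - b) / (R - a) + 1) * ‖x - y‖ := by
  set L := b / a + (R - b) / (R - a) + 1
  have hκ : 0 < (R - b) / (R - a) := div_pos (by linarith) (by linarith)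
  have hba : 0 < b / a := div_pos hb ha
  have hL : 0 < L := by positivity
  have lip : ∀ s t, |radialProfile a b R s - radialProfile a b R t| ≤ L * |s - t| := fun s t =>
    abs_radialProfile_sub_le ha hb haR hbR
  have bd : ∀ t, 0 ≤ t → radialProfile a b R t ≤ L * t := fun t ht => by
    have := lip t 0
    rw [radialProfile_of_le haR ha.le, mul_zero, sub_zero, sub_zero, abs_of_nonneg ht] at this
    exact (le_abs_self _).trans this
  rcases eq_or_ne x 0 with rfl | hx
  · have h1 : radialMap a b R (0 : X) = 0 := by simp [radialMap]
    rw [h1, zero_sub, norm_neg, zero_sub, norm_neg, norm_radialMap ha hb haR hbR]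
    have := bd ‖y‖ (norm_nonneg y)
    nlinarith [mul_nonneg hL.le (norm_nonneg y)]
  rcases eq_or_ne y 0 with rfl | hy
  · have h1 : radialMap a b R (0 : X) = 0 := by simp [radialMap]
    rw [h1, sub_zero, sub_zero, norm_radialMap ha hb haR hbR]
    have := bd ‖x‖ (norm_nonneg x)
    nlinarith [mul_nonneg hL.le (norm_nonneg x)]
  have hx' : 0 < ‖x‖ := norm_pos_iff.2 hx
  have hy' : 0 < ‖y‖ := norm_pos_iff.2 hy
  have hs : |‖x‖ - ‖y‖| ≤ ‖x - y‖ := abs_norm_sub_norm_le x y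
  set p := radialProfile a b R ‖x‖
  set q := radialProfile a b R ‖y‖
  have hp : 0 ≤ p := radialProfile_nonneg ha hb haR hbR hx'.le
  have hpx : p / ‖x‖ ≤ L := (div_le_iff₀ hx').2 (bd _ hx'.le)
  have hpx0 : 0 ≤ p / ‖x‖ := div_nonneg hp hx'.le
  have e : radialMap a b R x - radialMap a b R y =
      (p / ‖x‖) • (x - y) + ((p / ‖x‖ * (‖y‖ - ‖x‖) + (p - q)) / ‖y‖) • y := by
    have : (p / ‖x‖ * (‖y‖ - ‖x‖) + (p - q)) / ‖y‖ = p / ‖x‖ - q / ‖y‖ := by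
      field_simp
      ring
    rw [this]
    simp only [radialMap, smul_sub, sub_smul]
    abel
  rw [e]
  have n1 : ‖(p / ‖x‖) • (x - y)‖ ≤ L * ‖x - y‖ := by
    rw [norm_smul, Real.norm_of_nonneg hpx0]
    gcongr
  have n2 : ‖((p / ‖x‖ * (‖y‖ - ‖x‖) + (p - q)) / ‖y‖) • y‖ ≤ 2 * L * ‖x - y‖ := by
    rw [norm_smul, norm_div, norm_norm, div_mul_cancel₀ _ hy'.ne', Real.norm_eq_abs]
    refine (abs_add_le _ _).trans ?_
    rw [abs_mul, abs_of_nonneg hpx0, abs_sub_comm ‖y‖]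
    have h1 : p / ‖x‖ * |‖x‖ - ‖y‖| ≤ L * ‖x - y‖ := by gcongr
    have h2 := (lip ‖x‖ ‖y‖).trans (mul_le_mul_of_nonneg_left hs hL.le)
    linarith
  calc _ ≤ _ := norm_add_le _ _
    _ ≤ _ := by linarith

end Radial

lemma nonpos_of_le_mul_of_bddAbove {α : Type*} {e : α → ℝ} {θ M : ℝ} (hθ0 : 0 ≤ θ) (hθ1 : θ < 1)
    (hM : ∀ x, e x ≤ M) (h : ∀ x, e x ≤ 0 ∨ ∃ y, e x ≤ θ * e y) (x : α) : e x ≤ 0 := by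
  have key : ∀ k : ℕ, ∀ x, e x ≤ θ ^ k * |M| := by
    intro k
    induction k with
    | zero => intro x; simpa using (hM x).trans (le_abs_self M)
    | succ k ih =>
      intro x
      rcases h x with h | ⟨y, hy⟩
      · exact h.trans (by positivity)
      · calc e x ≤ θ * e y := hy
          _ ≤ θ * (θ ^ k * |M|) := mul_le_mul_of_nonneg_left (ih y) hθ0
          _ = θ ^ (k + 1) * |M| := by ring
  have lim : Tendsto (fun k : ℕ => θ ^ k * |M|) atTop (𝓝 0) := by
    simpa using (tendsto_pow_atTop_nhds_zero_of_lt_one hθ0 hθ1).mul_const |M|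
  exact ge_of_tendsto' lim fun k => key k x

/-- Data for a pair of self-similar Cantor sets with the same centres `c i` and contraction
ratios `a` and `b`. The balls of radius `1 / 2` about the centres lie in the unit ball and have
disjoint interiors. -/
structure CubeConfig (X ι : Type*) [NormedAddCommGroup X] where
  /-- The centres of the first-generation balls. -/
  c : ι → X
  /-- The contraction ratio of the source. -/
  a : ℝ
  /-- The contraction ratio of the target. -/
  b : ℝ
  /-- The radius beyond which the first-generation map is the identity. -/
  R : ℝ
  /-- A point outside the open unit ball. -/
  p : X
  a_pos : 0 < a
  b_pos : 0 < b
  a_lt : a < R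
  b_lt : b < R
  R_lt : R < 1 / 2
  norm_c_le : ∀ i, ‖c i‖ ≤ 1 / 2
  one_le_sep : ∀ i j, i ≠ j → 1 ≤ ‖c i - c j‖
  one_le_norm_p : 1 ≤ ‖p‖

namespace CubeConfig

variable {X ι : Type*} [NormedAddCommGroup X]

/-- Exchange the roles of source and target. -/
def swap (C : CubeConfig X ι) : CubeConfig X ι where
  c := C.c
  a := C.b
  b := C.a
  R := C.R
  p := C.p
  a_pos := C.b_pos
  b_pos := C.a_pos
  a_lt := C.b_lt
  b_lt := C.a_lt
  R_lt := C.R_lt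
  norm_c_le := C.norm_c_le
  one_le_sep := C.one_le_sep
  one_le_norm_p := C.one_le_norm_p

variable (C : CubeConfig X ι)

lemma eq_of_norm_lt {i j : ι} {x : X} (hi : ‖x - C.c i‖ ≤ 1 / 2) (hj : ‖x - C.c j‖ < 1 / 2) :
    i = j := by
  by_contra h
  have h1 := C.one_le_sep i j h
  have h2 : ‖C.c i - C.c j‖ ≤ ‖x - C.c j‖ + ‖x - C.c i‖ := by
    have := norm_sub_le (x - C.c j) (x - C.c i)
    rwa [sub_sub_sub_cancel_left] at this
  linarith

lemma b_lt_half : C.b < 1 / 2 := C.b_lt.trans C.R_lt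

lemma half_le_norm_sub {x : X} (hx : 1 ≤ ‖x‖) (i : ι) : 1 / 2 ≤ ‖x - C.c i‖ := by
  have h1 := norm_sub_norm_le x (C.c i)
  have h2 := C.norm_c_le i
  linarith

variable [NormedSpace ℝ X]

lemma norm_radialMap_le_R {x : X} (hx : ‖x‖ ≤ C.R) : ‖radialMap C.a C.b C.R x‖ ≤ C.R := by
  rw [norm_radialMap C.a_pos C.b_pos C.a_lt C.b_lt]
  exact radialProfile_le C.a_pos C.b_pos C.a_lt C.b_lt hx

lemma norm_inv_smul_le {x : X} {i : ι} (h : ‖x - C.c i‖ ≤ C.a) :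
    ‖C.a⁻¹ • (x - C.c i)‖ ≤ 1 := by
  rw [norm_smul, norm_inv, Real.norm_of_nonneg C.a_pos.le]
  exact inv_mul_le_one_of_le₀ h C.a_pos.le

/-- The map `x ↦ c i + (b / a) (x - c i)` on the ball of radius `a` about `c i`, extended
radially to the ball of radius `R` and by the identity elsewhere. -/
def shell [Fintype ι] (x : X) : X :=
  x + ∑ i, (radialMap C.a C.b C.R (x - C.c i) - (x - C.c i))

/-- The first-generation ball of radius `a` containing a point is rescaled to the unit ball; points
outside all such balls are sent to `p`. -/
def expand (x : X) : X :=
  open Classical in if h : ∃ i, ‖x - C.c i‖ ≤ C.a then C.a⁻¹ • (x - C.c h.choose) else C.p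

lemma expand_of_mem {i : ι} {x : X} (h : ‖x - C.c i‖ ≤ C.a) :
    C.expand x = C.a⁻¹ • (x - C.c i) := by
  have hex : ∃ i, ‖x - C.c i‖ ≤ C.a := ⟨i, h⟩
  have hR := C.R_lt
  have ha := C.a_lt
  rw [expand, dif_pos hex, C.eq_of_norm_lt (h.trans (by linarith))
    (hex.choose_spec.trans_lt (by linarith))]

lemma expand_of_forall_lt {x : X} (h : ∀ i, C.a < ‖x - C.c i‖) : C.expand x = C.p :=
  dif_neg fun ⟨i, hi⟩ => (h i).not_ge hi

lemma expand_p : C.expand C.p = C.p :=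
  C.expand_of_forall_lt fun i =>
    (C.a_lt.trans C.R_lt).trans_le (C.half_le_norm_sub C.one_le_norm_p i)

variable [Fintype ι]

lemma shell_of_near {i : ι} {x : X} (hx : ‖x - C.c i‖ ≤ 1 / 2) :
    C.shell x = C.c i + radialMap C.a C.b C.R (x - C.c i) := by
  rw [shell, Finset.sum_eq_single i]
  · abel
  · intro j _ hj
    have : C.R ≤ ‖x - C.c j‖ := by
      by_contra! h
      exact hj (C.eq_of_norm_lt hx (h.trans C.R_lt)).symm
    rw [radialMap_of_ge C.a_pos C.a_lt this, sub_self]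
  · simp

lemma shell_of_far {x : X} (hx : ∀ i, C.R ≤ ‖x - C.c i‖) : C.shell x = x := by
  rw [shell, Finset.sum_eq_zero, add_zero]
  intro i _
  rw [radialMap_of_ge C.a_pos C.a_lt (hx i), sub_self]

lemma shell_of_half_add_le {x : X} (hx : 1 / 2 + C.R ≤ ‖x‖) : C.shell x = x := by
  refine C.shell_of_far fun i => ?_
  have h1 := norm_sub_norm_le x (C.c i)
  have h2 := C.norm_c_le i
  linarith

lemma shell_p : C.shell C.p = C.p :=
  C.shell_of_half_add_le (by linarith [C.one_le_norm_p, C.R_lt])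

lemma shell_of_mem {i : ι} {x : X} (hx : ‖x - C.c i‖ ≤ C.a) :
    C.shell x = C.c i + (C.b / C.a) • (x - C.c i) := by
  rw [C.shell_of_near (hx.trans (C.a_lt.trans C.R_lt).le), radialMap_of_le C.a_lt hx]

/-- Either `x` is in one of the balls of radius `R` about the centres or `shell` fixes it. -/
lemma near_or_shell_eq (x : X) : (∃ i, ‖x - C.c i‖ ≤ C.R) ∨
    ((∀ i, C.R ≤ ‖x - C.c i‖) ∧ C.shell x = x) := by
  by_cases h : ∃ i, ‖x - C.c i‖ ≤ C.R
  · exact Or.inl h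
  · push Not at h
    exact Or.inr ⟨fun i => (h i).le, C.shell_of_far fun i => (h i).le⟩

lemma shell_swap_shell (x : X) : C.swap.shell (C.shell x) = x := by
  rcases C.near_or_shell_eq x with ⟨i, hi⟩ | ⟨h, hx⟩
  · have h1 := C.shell_of_near (hi.trans C.R_lt.le)
    have h2 : C.shell x - C.c i = radialMap C.a C.b C.R (x - C.c i) := by
      rw [h1, add_sub_cancel_left]
    have h3 : ‖C.shell x - C.swap.c i‖ ≤ 1 / 2 := by
      change ‖C.shell x - C.c i‖ ≤ 1 / 2
      rw [h2]
      exact (C.norm_radialMap_le_R hi).trans C.R_lt.le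
    rw [C.swap.shell_of_near h3]
    change C.c i + radialMap C.b C.a C.R (C.shell x - C.c i) = x
    rw [h2, radialMap_radialMap C.a_pos C.b_pos C.a_lt C.b_lt, add_sub_cancel]
  · rw [hx]
    exact C.swap.shell_of_far h

lemma norm_shell_sub_self_le (x : X) : ‖C.shell x - x‖ ≤ 1 := by
  rcases C.near_or_shell_eq x with ⟨i, hi⟩ | ⟨-, hx⟩
  · rw [C.shell_of_near (hi.trans C.R_lt.le)]
    have e : C.c i + radialMap C.a C.b C.R (x - C.c i) - x =
        radialMap C.a C.b C.R (x - C.c i) - (x - C.c i) := by abel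
    rw [e]
    refine (norm_sub_le _ _).trans ?_
    linarith [C.norm_radialMap_le_R hi, C.R_lt]
  · rw [hx, sub_self, norm_zero]
    exact zero_le_one

lemma norm_shell_le_one {x : X} (h : ‖x‖ ≤ 1) : ‖C.shell x‖ ≤ 1 := by
  rcases C.near_or_shell_eq x with ⟨i, hi⟩ | ⟨-, hx⟩
  · rw [C.shell_of_near (hi.trans C.R_lt.le)]
    refine (norm_add_le _ _).trans ?_
    linarith [C.norm_radialMap_le_R hi, C.R_lt, C.norm_c_le i]
  · rwa [hx]

lemma lt_norm_shell_sub {x : X} (h : ∀ i, C.a < ‖x - C.c i‖) (i : ι) :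
    C.b < ‖C.shell x - C.c i‖ := by
  by_contra! hle
  have h1 : C.swap.shell (C.shell x) = C.c i + (C.a / C.b) • (C.shell x - C.c i) :=
    C.swap.shell_of_mem hle
  rw [C.shell_swap_shell] at h1
  have h2 : ‖x - C.c i‖ ≤ C.a := by
    rw [h1, add_sub_cancel_left, norm_smul,
      Real.norm_of_nonneg (div_pos C.a_pos C.b_pos).le]
    calc C.a / C.b * ‖C.shell x - C.c i‖ ≤ C.a / C.b * C.b :=
          mul_le_mul_of_nonneg_left hle (div_pos C.a_pos C.b_pos).le
      _ = C.a := div_mul_cancel₀ _ C.b_pos.ne'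
  exact (h i).not_ge h2

lemma exists_shell_lipschitz :
    ∃ L : ℝ, 1 ≤ L ∧ ∀ x y, ‖C.shell x - C.shell y‖ ≤ L * ‖x - y‖ := by
  set L₀ := 3 * (C.b / C.a + (C.R - C.b) / (C.R - C.a) + 1)
  have hL₀ : 0 ≤ L₀ := by
    have h1 : 0 < C.R - C.b := sub_pos.2 C.b_lt
    have h2 : 0 < C.R - C.a := sub_pos.2 C.a_lt
    have h3 := C.a_pos
    have h4 := C.b_pos
    positivity
  refine ⟨1 + ∑ _i : ι, (L₀ + 1), le_add_of_nonneg_right (by positivity), fun x y => ?_⟩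
  have e : C.shell x - C.shell y = (x - y) + ∑ i, ((radialMap C.a C.b C.R (x - C.c i) -
      radialMap C.a C.b C.R (y - C.c i)) - (x - y)) := by
    have : ∑ i, ((radialMap C.a C.b C.R (x - C.c i) -
        radialMap C.a C.b C.R (y - C.c i)) - (x - y)) =
        ∑ i, (radialMap C.a C.b C.R (x - C.c i) - (x - C.c i)) -
        ∑ i, (radialMap C.a C.b C.R (y - C.c i) - (y - C.c i)) := by
      rw [← Finset.sum_sub_distrib]
      exact Finset.sum_congr rfl fun i _ => by abel
    rw [this, shell, shell]
    abel
  rw [e, add_mul, one_mul, Finset.sum_mul]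
  refine (norm_add_le _ _).trans (add_le_add_right ((norm_sum_le _ _).trans
    (Finset.sum_le_sum fun i _ => ?_)) _)
  refine (norm_sub_le _ _).trans ?_
  have := norm_radialMap_sub_le C.a_pos C.b_pos C.a_lt C.b_lt (x - C.c i) (y - C.c i)
  rw [sub_sub_sub_cancel_right] at this
  linarith

/-- The displacement of `cantorMap`. -/
def disp (x : X) : X := ∑' k : ℕ, C.b ^ k • (C.shell (C.expand^[k] x) - C.expand^[k] x)

/-- The homeomorphism carrying the Cantor set of ratio `a` to the Cantor set of ratio `b`. -/
def cantorMap (x : X) : X := x + C.disp x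

lemma norm_disp_term_le (x : X) (k : ℕ) :
    ‖C.b ^ k • (C.shell (C.expand^[k] x) - C.expand^[k] x)‖ ≤ (1 / 2) ^ k := by
  rw [norm_smul, norm_pow, Real.norm_of_nonneg C.b_pos.le]
  calc C.b ^ k * _ ≤ (1 / 2) ^ k * 1 :=
        mul_le_mul (pow_le_pow_left₀ C.b_pos.le C.b_lt_half.le k) (C.norm_shell_sub_self_le _)
          (norm_nonneg _) (by positivity)
    _ = _ := mul_one _

lemma norm_disp_le (x : X) : ‖C.disp x‖ ≤ 2 :=
  tsum_of_norm_bounded hasSum_geometric_two (C.norm_disp_term_le x)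

lemma norm_cantorMap_sub_self_le (x : X) : ‖C.cantorMap x - x‖ ≤ 2 := by
  rw [cantorMap, add_sub_cancel_left]
  exact C.norm_disp_le x

variable [CompleteSpace X]

lemma disp_eq (x : X) : C.disp x = (C.shell x - x) + C.b • C.disp (C.expand x) := by
  have hs : Summable fun k : ℕ => C.b ^ k • (C.shell (C.expand^[k] x) - C.expand^[k] x) :=
    Summable.of_norm_bounded summable_geometric_two (C.norm_disp_term_le x)
  have hs' : Summable fun k : ℕ =>
      C.b ^ k • (C.shell (C.expand^[k] (C.expand x)) - C.expand^[k] (C.expand x)) :=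
    Summable.of_norm_bounded summable_geometric_two (C.norm_disp_term_le _)
  rw [disp, hs.tsum_eq_zero_add, disp, ← hs'.tsum_const_smul]
  simp only [pow_zero, one_smul, Function.iterate_zero, id, Function.iterate_succ_apply,
    smul_smul, pow_succ']

lemma disp_p : C.disp C.p = 0 := by
  have h := C.disp_eq C.p
  rw [C.expand_p, C.shell_p, sub_self, zero_add] at h
  have h2 : (1 - C.b) • C.disp C.p = 0 := by rw [sub_smul, one_smul, ← h, sub_self]
  refine (smul_eq_zero.1 h2).resolve_left ?_
  linarith [C.b_lt_half]

lemma cantorMap_of_forall_lt {x : X} (h : ∀ i, C.a < ‖x - C.c i‖) :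
    C.cantorMap x = C.shell x := by
  rw [cantorMap, C.disp_eq, C.expand_of_forall_lt h, C.disp_p, smul_zero]
  abel

lemma cantorMap_of_mem {i : ι} {x : X} (h : ‖x - C.c i‖ ≤ C.a) :
    C.cantorMap x = C.c i + C.b • C.cantorMap (C.a⁻¹ • (x - C.c i)) := by
  rw [cantorMap, C.disp_eq, C.expand_of_mem h, C.shell_of_mem h, cantorMap, smul_add, smul_smul,
    div_eq_mul_inv]
  abel

lemma norm_cantorMap_le_one {x : X} (hx : ‖x‖ ≤ 1) : ‖C.cantorMap x‖ ≤ 1 := by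
  have key := nonpos_of_le_mul_of_bddAbove (α := {x : X // ‖x‖ ≤ 1})
    (e := fun x => ‖C.cantorMap x‖ - 1) (θ := C.b) (M := 2) C.b_pos.le
    (by linarith [C.b_lt_half]) ?_ ?_ ⟨x, hx⟩
  · simpa using key
  · rintro ⟨x, hx⟩
    have h1 := C.norm_disp_le x
    have h2 : ‖C.cantorMap x‖ ≤ ‖x‖ + ‖C.disp x‖ := norm_add_le _ _
    change ‖C.cantorMap x‖ - 1 ≤ 2
    linarith
  · rintro ⟨x, hx⟩
    by_cases h : ∃ i, ‖x - C.c i‖ ≤ C.a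
    · obtain ⟨i, hi⟩ := h
      refine Or.inr ⟨⟨_, C.norm_inv_smul_le hi⟩, ?_⟩
      change ‖C.cantorMap x‖ - 1 ≤ C.b * (‖C.cantorMap (C.a⁻¹ • (x - C.c i))‖ - 1)
      have h1 := norm_add_le (C.c i) (C.b • C.cantorMap (C.a⁻¹ • (x - C.c i)))
      rw [← C.cantorMap_of_mem hi, norm_smul, Real.norm_of_nonneg C.b_pos.le] at h1
      linarith [C.norm_c_le i, C.b_lt_half]
    · push Not at h
      left
      change ‖C.cantorMap x‖ - 1 ≤ 0
      rw [C.cantorMap_of_forall_lt h]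
      linarith [C.norm_shell_le_one hx]

lemma cantorMap_swap_cantorMap (x : X) : C.swap.cantorMap (C.cantorMap x) = x := by
  have key := nonpos_of_le_mul_of_bddAbove
    (e := fun x => ‖C.swap.cantorMap (C.cantorMap x) - x‖) (θ := C.a) (M := 4) C.a_pos.le
    (by linarith [C.swap.b_lt_half, show C.swap.b = C.a from rfl]) ?_ ?_ x
  · exact sub_eq_zero.1 (norm_le_zero_iff.1 key)
  · intro x
    have h1 := C.swap.norm_cantorMap_sub_self_le (C.cantorMap x)
    have h2 := C.norm_cantorMap_sub_self_le x
    have h3 := norm_add_le (C.swap.cantorMap (C.cantorMap x) - C.cantorMap x) (C.cantorMap x - x)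
    rw [sub_add_sub_cancel] at h3
    exact h3.trans (by linarith)
  · intro x
    by_cases h : ∃ i, ‖x - C.c i‖ ≤ C.a
    · obtain ⟨i, hi⟩ := h
      right
      set y := C.a⁻¹ • (x - C.c i)
      refine ⟨y, ?_⟩
      have h1 : C.cantorMap x - C.c i = C.b • C.cantorMap y := by
        rw [C.cantorMap_of_mem hi, add_sub_cancel_left]
      have h2 : ‖C.cantorMap x - C.c i‖ ≤ C.b := by
        rw [h1, norm_smul, Real.norm_of_nonneg C.b_pos.le]
        exact mul_le_of_le_one_right C.b_pos.le
          (C.norm_cantorMap_le_one (C.norm_inv_smul_le hi))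
      have h3 : C.swap.cantorMap (C.cantorMap x) =
          C.c i + C.a • C.swap.cantorMap (C.b⁻¹ • (C.cantorMap x - C.c i)) :=
        C.swap.cantorMap_of_mem h2
      rw [h1, inv_smul_smul₀ C.b_pos.ne'] at h3
      have h4 : C.swap.cantorMap (C.cantorMap x) - x =
          C.a • (C.swap.cantorMap (C.cantorMap y) - y) := by
        rw [h3, smul_sub, show C.a • y = x - C.c i from smul_inv_smul₀ C.a_pos.ne' _]
        abel
      change ‖_‖ ≤ _
      rw [h4, norm_smul, Real.norm_of_nonneg C.a_pos.le]
    · push Not at h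
      left
      have h1 : C.swap.cantorMap (C.shell x) = C.swap.shell (C.shell x) :=
        C.swap.cantorMap_of_forall_lt (C.lt_norm_shell_sub h)
      change ‖_‖ ≤ _
      rw [C.cantorMap_of_forall_lt h, h1, C.shell_swap_shell, sub_self, norm_zero]

lemma cantorMap_of_half_add_le {x : X} (hx : 1 / 2 + C.R ≤ ‖x‖) : C.cantorMap x = x := by
  rw [C.cantorMap_of_forall_lt fun i => ?_, C.shell_of_half_add_le hx]
  have h1 := norm_sub_norm_le x (C.c i)
  have h2 := C.norm_c_le i
  linarith [C.a_lt]

lemma cantorMap_eq_shell {i : ι} {x : X} (h : ‖x - C.c i‖ ≤ C.a)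
    (h' : C.a * (1 / 2 + C.R) ≤ ‖x - C.c i‖) : C.cantorMap x = C.shell x := by
  have h1 : 1 / 2 + C.R ≤ ‖C.a⁻¹ • (x - C.c i)‖ := by
    rwa [norm_smul, norm_inv, Real.norm_of_nonneg C.a_pos.le, le_inv_mul_iff₀ C.a_pos]
  rw [C.cantorMap_of_mem h, C.cantorMap_of_half_add_le h1, C.shell_of_mem h, smul_smul,
    div_eq_mul_inv]

/-- A radius such that every ball of this radius lies in a first-generation ball or in the region
where `cantorMap` agrees with `shell`. -/
def scale : ℝ := C.a * (1 / 2 - C.R) / 2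

lemma scale_pos : 0 < C.scale :=
  half_pos (mul_pos C.a_pos (sub_pos.2 C.R_lt))

lemma ball_subset_or_eq_shell (x : X) : (∃ i, ∀ z, ‖z - x‖ ≤ C.scale → ‖z - C.c i‖ ≤ C.a) ∨
    ∀ z, ‖z - x‖ ≤ C.scale → C.cantorMap z = C.shell z := by
  have hR := C.R_lt
  have haR := C.a_lt
  have ha := C.a_pos
  have hs : 2 * C.scale = C.a * (1 / 2 - C.R) := by unfold scale; ring
  by_cases h : ∃ i x', ‖x' - x‖ ≤ C.scale ∧ ‖x' - C.c i‖ ≤ C.a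
  · obtain ⟨i, x', hx', hi⟩ := h
    by_cases h2 : ∀ z, ‖z - x‖ ≤ C.scale → ‖z - C.c i‖ ≤ C.a
    · exact Or.inl ⟨i, h2⟩
    right
    push Not at h2
    obtain ⟨y, hy, hyi⟩ := h2
    intro z hz
    have close : ∀ u v, ‖u - x‖ ≤ C.scale → ‖v - x‖ ≤ C.scale →
        ‖u - C.c i‖ ≤ ‖v - C.c i‖ + 2 * C.scale := by
      intro u v hu hv
      have h1 := norm_add_le (v - C.c i) ((u - x) - (v - x))
      have h2 := norm_sub_le (u - x) (v - x)
      rw [show v - C.c i + ((u - x) - (v - x)) = u - C.c i by abel] at h1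
      linarith
    have h1 := close z x' hz hx'
    have h2 := close y z hy hz
    by_cases h3 : ‖z - C.c i‖ ≤ C.a
    · exact C.cantorMap_eq_shell h3 (by linarith)
    · refine C.cantorMap_of_forall_lt fun j => ?_
      by_contra! hj
      have hz' : ‖z - C.c i‖ < 1 / 2 := by nlinarith
      have := C.eq_of_norm_lt hz'.le (hj.trans_lt (haR.trans hR))
      subst this
      exact h3 hj
  · push Not at h
    exact Or.inr fun z hz => C.cantorMap_of_forall_lt fun i => h i z hz

lemma norm_cantorMap_sub_of_mem {i : ι} {x y : X} (hx : ‖x - C.c i‖ ≤ C.a)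
    (hy : ‖y - C.c i‖ ≤ C.a) : ‖C.cantorMap x - C.cantorMap y‖ =
      C.b * ‖C.cantorMap (C.a⁻¹ • (x - C.c i)) - C.cantorMap (C.a⁻¹ • (y - C.c i))‖ := by
  rw [C.cantorMap_of_mem hx, C.cantorMap_of_mem hy, add_sub_add_left_eq_sub, ← smul_sub,
    norm_smul, Real.norm_of_nonneg C.b_pos.le]

lemma norm_inv_smul_sub (i : ι) (x y : X) :
    ‖C.a⁻¹ • (x - C.c i) - C.a⁻¹ • (y - C.c i)‖ = C.a⁻¹ * ‖x - y‖ := by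
  rw [← smul_sub, sub_sub_sub_cancel_right, norm_smul, norm_inv, Real.norm_of_nonneg C.a_pos.le]

lemma norm_cantorMap_sub_le_add (x y : X) :
    ‖C.cantorMap x - C.cantorMap y‖ ≤ ‖x - y‖ + 4 := by
  have h1 := C.norm_disp_le x
  have h2 := C.norm_disp_le y
  have h3 := norm_sub_le (C.disp x) (C.disp y)
  have h4 := norm_add_le (x - y) (C.disp x - C.disp y)
  rw [cantorMap, cantorMap, add_sub_add_comm]
  linarith

lemma norm_sub_le_norm_cantorMap_sub_add (x y : X) :
    ‖x - y‖ ≤ ‖C.cantorMap x - C.cantorMap y‖ + 4 := by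
  simpa only [cantorMap_swap_cantorMap] using
    C.swap.norm_cantorMap_sub_le_add (C.cantorMap x) (C.cantorMap y)

lemma exists_norm_cantorMap_sub_le :
    ∃ M : ℝ, 0 < M ∧ ∀ (k : ℕ) (x y : X), ‖x - y‖ ≤ C.scale * C.a ^ k →
      ‖C.cantorMap x - C.cantorMap y‖ ≤ M * C.R ^ k := by
  obtain ⟨L, hL, hlip⟩ := C.exists_shell_lipschitz
  have hs := C.scale_pos
  have ha := C.a_pos
  have haR := C.a_lt
  have hbR := C.b_lt
  have ha1 : C.a ≤ 1 := by linarith [C.R_lt]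
  refine ⟨C.scale + 4 + L * C.scale, by positivity, fun k => ?_⟩
  induction k with
  | zero =>
    intro x y hxy
    have := C.norm_cantorMap_sub_le_add x y
    have : 0 < L * C.scale := by positivity
    linarith
  | succ k ih =>
    intro x y hxy
    have hxy' : ‖x - y‖ ≤ C.scale :=
      hxy.trans (mul_le_of_le_one_right hs.le (pow_le_one₀ ha.le ha1))
    have hyy : ‖y - y‖ ≤ C.scale := by simpa using hs.le
    rcases C.ball_subset_or_eq_shell y with ⟨i, hi⟩ | h
    · rw [C.norm_cantorMap_sub_of_mem (hi x hxy') (hi y hyy), pow_succ']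
      have h1 := ih (C.a⁻¹ • (x - C.c i)) (C.a⁻¹ • (y - C.c i)) (by
        rw [C.norm_inv_smul_sub, inv_mul_le_iff₀ ha]
        exact hxy.trans (le_of_eq (by ring)))
      have hRk : 0 ≤ (C.scale + 4 + L * C.scale) * C.R ^ k := (norm_nonneg _).trans h1
      calc _ ≤ C.b * ((C.scale + 4 + L * C.scale) * C.R ^ k) :=
            mul_le_mul_of_nonneg_left h1 C.b_pos.le
        _ ≤ C.R * ((C.scale + 4 + L * C.scale) * C.R ^ k) :=
            mul_le_mul_of_nonneg_right hbR.le hRk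
        _ = _ := by ring
    · rw [h x hxy', h y hyy]
      calc _ ≤ L * ‖x - y‖ := hlip x y
        _ ≤ L * (C.scale * C.a ^ (k + 1)) := by gcongr
        _ ≤ L * (C.scale * C.R ^ (k + 1)) := by gcongr
        _ ≤ _ := by
          rw [← mul_assoc]
          exact mul_le_mul_of_nonneg_right (by linarith) (by have := ha.trans haR; positivity)

lemma uniformContinuous_cantorMap : UniformContinuous C.cantorMap := by
  obtain ⟨M, hM, h⟩ := C.exists_norm_cantorMap_sub_le
  rw [Metric.uniformContinuous_iff]
  intro ε hε
  have hR0 : 0 < C.R := C.a_pos.trans C.a_lt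
  obtain ⟨k, hk⟩ := exists_pow_lt_of_lt_one (div_pos hε hM) (C.R_lt.trans one_half_lt_one)
  refine ⟨C.scale * C.a ^ k, mul_pos C.scale_pos (pow_pos C.a_pos k), fun x y hxy => ?_⟩
  rw [dist_eq_norm] at hxy ⊢
  refine (h k x y hxy.le).trans_lt ?_
  rwa [lt_div_iff₀ hM, mul_comm] at hk

/-- `cantorMap` is weakly quasisymmetric. -/
lemma exists_weak_quasisymmetry {A : ℝ} (hA : 1 ≤ A) :
    ∃ H : ℝ, 1 ≤ H ∧ ∀ x y z : X, ‖y - x‖ ≤ A * ‖z - x‖ →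
      ‖C.cantorMap y - C.cantorMap x‖ ≤ H * ‖C.cantorMap z - C.cantorMap x‖ := by
  obtain ⟨L, hL, hlip⟩ := C.exists_shell_lipschitz
  obtain ⟨L', hL', hlip'⟩ := C.swap.exists_shell_lipschitz
  have hs := C.scale_pos
  have ha := C.a_pos
  have hA0 : 0 < A := by linarith
  obtain ⟨δ, hδ, hδu⟩ := Metric.uniformContinuous_iff.1 C.swap.uniformContinuous_cantorMap
    (C.scale / A) (by positivity)
  set H := A + 4 * (A + 1) / δ + L * A * L'
  have large : ∀ x y z : X, C.scale ≤ A * ‖z - x‖ → ‖y - x‖ ≤ A * ‖z - x‖ →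
      ‖C.cantorMap y - C.cantorMap x‖ ≤ H * ‖C.cantorMap z - C.cantorMap x‖ := by
    intro x y z hz hyz
    have h1 : δ ≤ ‖C.cantorMap z - C.cantorMap x‖ := by
      by_contra! hlt
      have := hδu (a := C.cantorMap z) (b := C.cantorMap x) (by rwa [dist_eq_norm])
      rw [cantorMap_swap_cantorMap, cantorMap_swap_cantorMap, dist_eq_norm,
        lt_div_iff₀ hA0] at this
      linarith
    have h2 := C.norm_cantorMap_sub_le_add y x
    have h3 := mul_le_mul_of_nonneg_left (C.norm_sub_le_norm_cantorMap_sub_add z x) hA0.le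
    have h4 : 4 * (A + 1) ≤ 4 * (A + 1) / δ * ‖C.cantorMap z - C.cantorMap x‖ := by
      rw [div_mul_eq_mul_div, le_div_iff₀ hδ]
      gcongr
    have h5 : 0 ≤ L * A * L' * ‖C.cantorMap z - C.cantorMap x‖ := by positivity
    simp only [H, add_mul]
    linarith
  have key : ∀ (k : ℕ) (x y z : X), C.scale * C.a ^ k ≤ A * ‖z - x‖ → ‖y - x‖ ≤ A * ‖z - x‖ →
      ‖C.cantorMap y - C.cantorMap x‖ ≤ H * ‖C.cantorMap z - C.cantorMap x‖ := by
    intro k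
    induction k with
    | zero => intro x y z hz; exact large x y z (by simpa using hz)
    | succ k ih =>
      intro x y z hz hyz
      rcases le_or_gt C.scale (A * ‖z - x‖) with hl | hl
      · exact large x y z hl hyz
      have hz' : ‖z - x‖ ≤ C.scale := (le_mul_of_one_le_left (norm_nonneg _) hA).trans hl.le
      have hy' : ‖y - x‖ ≤ C.scale := hyz.trans hl.le
      have hx' : ‖x - x‖ ≤ C.scale := by simpa using hs.le
      rcases C.ball_subset_or_eq_shell x with ⟨i, hi⟩ | h
      · rw [C.norm_cantorMap_sub_of_mem (hi y hy') (hi x hx'),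
          C.norm_cantorMap_sub_of_mem (hi z hz') (hi x hx'), mul_left_comm]
        refine mul_le_mul_of_nonneg_left (ih _ _ _ ?_ ?_) C.b_pos.le
        · rw [C.norm_inv_smul_sub, mul_left_comm, le_inv_mul_iff₀ ha]
          exact (le_of_eq (by ring)).trans hz
        · rw [C.norm_inv_smul_sub, C.norm_inv_smul_sub, mul_left_comm]
          exact mul_le_mul_of_nonneg_left hyz (inv_nonneg.2 ha.le)
      · rw [h y hy', h z hz', h x hx']
        have h1 := hlip' (C.shell z) (C.shell x)
        rw [shell_swap_shell, shell_swap_shell] at h1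
        calc _ ≤ L * ‖y - x‖ := hlip y x
          _ ≤ L * (A * (L' * ‖C.shell z - C.shell x‖)) := by
            refine mul_le_mul_of_nonneg_left (hyz.trans ?_) (by linarith)
            exact mul_le_mul_of_nonneg_left h1 hA0.le
          _ = L * A * L' * ‖C.shell z - C.shell x‖ := by ring
          _ ≤ _ := by
            refine mul_le_mul_of_nonneg_right ?_ (norm_nonneg _)
            have : 0 < 4 * (A + 1) / δ := by positivity
            linarith
  refine ⟨H, ?_, fun x y z hyz => ?_⟩
  · have h1 : 0 < 4 * (A + 1) / δ := by positivity
    have h2 : 0 < L * A * L' := by positivity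
    linarith
  · rcases eq_or_ne z x with rfl | hzx
    · rw [sub_self, norm_zero, mul_zero] at hyz
      rw [sub_eq_zero.1 (norm_le_zero_iff.1 hyz)]
      simp
    · have hpos : 0 < A * ‖z - x‖ := mul_pos hA0 (norm_pos_iff.2 (sub_ne_zero.2 hzx))
      obtain ⟨k, hk⟩ := exists_pow_lt_of_lt_one (div_pos hpos hs)
        (C.a_lt.trans (C.R_lt.trans one_half_lt_one))
      rw [lt_div_iff₀ hs, mul_comm] at hk
      exact key k x y z hk.le hyz

end CubeConfig

section Coding

variable {X ι : Type*} [NormedAddCommGroup X] [NormedSpace ℝ X]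

/-- The point `∑ aᵏ c (w k)` of the self-similar set generated by the maps `x ↦ c i + a x`. -/
def codePoint (a : ℝ) (c : ι → X) (w : ℕ → ι) : X := ∑' k : ℕ, a ^ k • c (w k)

variable {a : ℝ} {c : ι → X}

lemma norm_codePoint_term_le (ha : 0 ≤ a) (ha2 : a ≤ 1 / 2) (hc : ∀ i, ‖c i‖ ≤ 1 / 2)
    (k : ℕ) (w : ℕ → ι) : ‖a ^ k • c (w k)‖ ≤ 1 / 2 * (1 / 2) ^ k := by
  rw [norm_smul, norm_pow, Real.norm_of_nonneg ha, mul_comm]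
  exact mul_le_mul (hc _) (pow_le_pow_left₀ ha ha2 k) (by positivity) (by norm_num)

lemma hasSum_half_mul_half_pow : HasSum (fun k : ℕ => (1 / 2 : ℝ) * (1 / 2) ^ k) 1 := by
  have h := hasSum_geometric_two.mul_left (1 / 2 : ℝ)
  rwa [show (1 / 2 : ℝ) * 2 = 1 by norm_num] at h

lemma norm_codePoint_le (ha : 0 ≤ a) (ha2 : a ≤ 1 / 2) (hc : ∀ i, ‖c i‖ ≤ 1 / 2) (w : ℕ → ι) :
    ‖codePoint a c w‖ ≤ 1 :=
  tsum_of_norm_bounded hasSum_half_mul_half_pow fun k => norm_codePoint_term_le ha ha2 hc k w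

lemma codePoint_eq [CompleteSpace X] (ha : 0 ≤ a) (ha2 : a ≤ 1 / 2) (hc : ∀ i, ‖c i‖ ≤ 1 / 2)
    (w : ℕ → ι) :
    codePoint a c w = c (w 0) + a • codePoint a c fun k => w (k + 1) := by
  have hs (w : ℕ → ι) : Summable fun k : ℕ => a ^ k • c (w k) :=
    Summable.of_norm_bounded hasSum_half_mul_half_pow.summable fun k =>
      norm_codePoint_term_le ha ha2 hc k w
  rw [codePoint, (hs w).tsum_eq_zero_add, codePoint, ← (hs _).tsum_const_smul]
  simp only [pow_zero, one_smul, smul_smul, pow_succ']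

lemma continuous_codePoint [CompleteSpace X] [TopologicalSpace ι] [DiscreteTopology ι] (ha : 0 ≤ a) (ha2 : a ≤ 1 / 2)
    (hc : ∀ i, ‖c i‖ ≤ 1 / 2) : Continuous (codePoint a c) :=
  continuous_tsum
    (fun k => (continuous_of_discreteTopology.comp (continuous_apply k)).const_smul (a ^ k))
    hasSum_half_mul_half_pow.summable fun k w => norm_codePoint_term_le ha ha2 hc k w

variable [CompleteSpace X]

lemma norm_codePoint_sub_le (ha : 0 ≤ a) (ha2 : a ≤ 1 / 2) (hc : ∀ i, ‖c i‖ ≤ 1 / 2) (k : ℕ) :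
    ∀ w v : ℕ → ι, (∀ j < k, w j = v j) → ‖codePoint a c w - codePoint a c v‖ ≤ 2 * a ^ k := by
  induction k with
  | zero =>
    intro w v _
    refine (norm_sub_le _ _).trans ?_
    have h1 := norm_codePoint_le ha ha2 hc w
    have h2 := norm_codePoint_le ha ha2 hc v
    rw [pow_zero]
    linarith
  | succ k ih =>
    intro w v h
    rw [codePoint_eq ha ha2 hc w, codePoint_eq ha ha2 hc v, h 0 k.succ_pos,
      add_sub_add_left_eq_sub, ← smul_sub, norm_smul, Real.norm_of_nonneg ha]
    calc _ ≤ a * (2 * a ^ k) :=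
          mul_le_mul_of_nonneg_left (ih _ _ fun j hj => h (j + 1) (by omega)) ha
      _ = _ := by ring

lemma le_norm_codePoint_sub (ha : 0 ≤ a) (ha2 : a ≤ 1 / 2) (hc : ∀ i, ‖c i‖ ≤ 1 / 2)
    (hsep : ∀ i j, i ≠ j → 1 ≤ ‖c i - c j‖) (k : ℕ) :
    ∀ w v : ℕ → ι, (∀ j < k, w j = v j) → w k ≠ v k →
      (1 - 2 * a) * a ^ k ≤ ‖codePoint a c w - codePoint a c v‖ := by
  induction k with
  | zero =>
    intro w v _ h
    have h1 := norm_codePoint_le ha ha2 hc fun k => w (k + 1)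
    have h2 := norm_codePoint_le ha ha2 hc fun k => v (k + 1)
    have h3 := norm_sub_le (codePoint a c fun k => w (k + 1)) (codePoint a c fun k => v (k + 1))
    have h4 := hsep _ _ h
    have e : c (w 0) - c (v 0) = (codePoint a c w - codePoint a c v) -
        a • ((codePoint a c fun k => w (k + 1)) - (codePoint a c fun k => v (k + 1))) := by
      rw [codePoint_eq ha ha2 hc w, codePoint_eq ha ha2 hc v, smul_sub]
      abel
    rw [e] at h4
    have h5 := h4.trans (norm_sub_le _ _)
    rw [norm_smul, Real.norm_of_nonneg ha] at h5
    have h6 := mul_le_mul_of_nonneg_left (h3.trans (add_le_add h1 h2)) ha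
    rw [pow_zero]
    linarith
  | succ k ih =>
    intro w v h hk
    rw [codePoint_eq ha ha2 hc w, codePoint_eq ha ha2 hc v, h 0 k.succ_pos,
      add_sub_add_left_eq_sub, ← smul_sub, norm_smul, Real.norm_of_nonneg ha]
    calc _ = a * ((1 - 2 * a) * a ^ k) := by ring
      _ ≤ _ := mul_le_mul_of_nonneg_left (ih _ _ (fun j hj => h (j + 1) (by omega)) hk) ha

lemma dimH_range_codePoint_le [Fintype ι] (ha : 0 < a) (ha2 : a ≤ 1 / 2)
    (hc : ∀ i, ‖c i‖ ≤ 1 / 2) {s : ℝ≥0} (hs : Fintype.card ι * a ^ (s : ℝ) = 1) :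
    dimH (range (codePoint a c)) ≤ s := by
  borelize X
  have hdiam (k : ℕ) (u : Fin k → ι) :
      ediam (codePoint a c '' {w | ∀ j : Fin k, w j = u j}) ≤ ENNReal.ofReal (2 * a ^ k) := by
    refine ediam_le ?_
    rintro _ ⟨w, hw, rfl⟩ _ ⟨v, hv, rfl⟩
    rw [edist_dist, dist_eq_norm]
    refine ENNReal.ofReal_le_ofReal (norm_codePoint_sub_le ha.le ha2 hc k w v fun j hj => ?_)
    exact (hw ⟨j, hj⟩).trans (hv ⟨j, hj⟩).symm
  have hr : Tendsto (fun k : ℕ => ENNReal.ofReal (2 * a ^ k)) atTop (𝓝 0) := by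
    rw [← ENNReal.ofReal_zero]
    refine ENNReal.tendsto_ofReal ?_
    simpa using (tendsto_pow_atTop_nhds_zero_of_lt_one ha.le (by linarith)).const_mul 2
  have hsum (k : ℕ) : ∑ u : Fin k → ι, ediam (codePoint a c '' {w | ∀ j : Fin k, w j = u j}) ^
      (s : ℝ) ≤ ENNReal.ofReal (2 ^ (s : ℝ)) := by
    calc _ ≤ ∑ u : Fin k → ι, ENNReal.ofReal (2 * a ^ k) ^ (s : ℝ) :=
          Finset.sum_le_sum fun u _ => ENNReal.rpow_le_rpow (hdiam k u) s.coe_nonneg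
      _ = ENNReal.ofReal ((Fintype.card ι : ℝ) ^ k * (2 * a ^ k) ^ (s : ℝ)) := by
        rw [Finset.sum_const, Finset.card_univ, Fintype.card_fun, Fintype.card_fin,
          nsmul_eq_mul, ENNReal.ofReal_rpow_of_nonneg (by positivity) s.coe_nonneg,
          ENNReal.ofReal_mul (by positivity), ENNReal.ofReal_pow (by positivity),
          ENNReal.ofReal_natCast, Nat.cast_pow]
      _ = ENNReal.ofReal (2 ^ (s : ℝ)) := by
        congr 1
        rw [Real.mul_rpow (by norm_num) (by positivity), ← Real.rpow_natCast a k,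
          ← Real.rpow_mul ha.le, mul_comm (k : ℝ), Real.rpow_mul ha.le, Real.rpow_natCast,
          mul_left_comm, ← mul_pow, hs, one_pow, mul_one]
  refine dimH_le_of_hausdorffMeasure_ne_top (ne_top_of_le_ne_top (b := ENNReal.ofReal (2 ^ (s : ℝ)))
    ENNReal.ofReal_ne_top ?_)
  refine (Measure.hausdorffMeasure_le_liminf_sum
    (ι := fun k => Fin k → ι) (s : ℝ) _ _ hr (fun k u => codePoint a c '' {w | ∀ j : Fin k, w j = u j})
    (Eventually.of_forall hdiam) (Eventually.of_forall fun k => ?_)).trans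
    (liminf_le_of_le (by isBoundedDefault) fun b hb => ?_)
  · rintro _ ⟨w, rfl⟩
    exact mem_iUnion.2 ⟨fun j => w j, w, fun j => rfl, rfl⟩
  · obtain ⟨k, hk⟩ := hb.exists
    exact hk.trans (hsum k)

lemma norm_codePoint_half_sub_le (ha : 0 < a) (ha2 : a < 1 / 2)
    (hc : ∀ i, ‖c i‖ ≤ 1 / 2) (hsep : ∀ i j, i ≠ j → 1 ≤ ‖c i - c j‖) {α : ℝ} (hα : 0 < α)
    (haα : a ^ α = 1 / 2) (w v : ℕ → ι) :
    ‖codePoint (1 / 2) c w - codePoint (1 / 2) c v‖ ≤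
      2 / (1 - 2 * a) ^ α * ‖codePoint a c w - codePoint a c v‖ ^ α := by
  have hpos : 0 < 1 - 2 * a := by linarith
  by_cases h : w = v
  · rw [h, sub_self, norm_zero]
    positivity
  · classical
    have hex : ∃ k, w k ≠ v k := Function.ne_iff.1 h
    have hlt : ∀ j < Nat.find hex, w j = v j := fun j hj => not_not.1 (Nat.find_min hex hj)
    have h1 := norm_codePoint_sub_le (a := 1 / 2) (by norm_num) le_rfl hc _ w v hlt
    have h2 := le_norm_codePoint_sub ha.le ha2.le hc hsep _ w v hlt (Nat.find_spec hex)
    have h3 := Real.rpow_le_rpow (by positivity) h2 hα.le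
    rw [Real.mul_rpow hpos.le (by positivity), ← Real.rpow_natCast a, ← Real.rpow_mul ha.le,
      mul_comm _ α, Real.rpow_mul ha.le, haα, Real.rpow_natCast] at h3
    refine h1.trans ?_
    rw [div_mul_eq_mul_div, le_div_iff₀ (by positivity)]
    linarith

lemma dimH_range_codePoint_half_le (ha : 0 < a) (ha2 : a < 1 / 2)
    (hc : ∀ i, ‖c i‖ ≤ 1 / 2) (hsep : ∀ i j, i ≠ j → 1 ≤ ‖c i - c j‖) {α : ℝ≥0} (hα : 0 < α)
    (haα : a ^ (α : ℝ) = 1 / 2) :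
    dimH (range (codePoint (1 / 2) c)) ≤ dimH (range (codePoint a c)) / α := by
  have key := norm_codePoint_half_sub_le ha ha2 hc hsep (NNReal.coe_pos.2 hα) haα
  have hfac : Function.FactorsThrough (codePoint (1 / 2) c) (codePoint a c) := by
    intro w v h
    have := key w v
    rw [h, sub_self, norm_zero, Real.zero_rpow (NNReal.coe_pos.2 hα).ne', mul_zero] at this
    exact sub_eq_zero.1 (norm_le_zero_iff.1 this)
  set g : X → X := Function.extend (codePoint a c) (codePoint (1 / 2) c) 0
  have hg (w : ℕ → ι) : g (codePoint a c w) = codePoint (1 / 2) c w := hfac.extend_apply 0 w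
  have hK : 0 ≤ 2 / (1 - 2 * a) ^ (α : ℝ) :=
    div_nonneg zero_le_two (Real.rpow_nonneg (by linarith) _)
  have hhol : HolderOnWith (2 / (1 - 2 * a) ^ (α : ℝ)).toNNReal α g (range (codePoint a c)) := by
    rintro _ ⟨w, rfl⟩ _ ⟨v, rfl⟩
    rw [hg, hg, edist_nndist, edist_nndist, ← ENNReal.coe_rpow_of_nonneg _ α.coe_nonneg, ← ENNReal.coe_mul,
      ENNReal.coe_le_coe, ← NNReal.coe_le_coe]
    push_cast
    rw [dist_eq_norm, dist_eq_norm, Real.coe_toNNReal _ hK]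
    exact key w v
  have himg : g '' range (codePoint a c) = range (codePoint (1 / 2) c) := by
    rw [← range_comp]
    exact congrArg range (funext hg)
  rw [← himg]
  exact hhol.dimH_image_le hα

lemma closedBall_subset_range_codePoint_half (hc : ∀ i, ‖c i‖ ≤ 1 / 2)
    (hcov : ∀ x : X, ‖x‖ ≤ 1 → ∃ i, ‖x - c i‖ ≤ 1 / 2) :
    closedBall 0 1 ⊆ range (codePoint (1 / 2) c) := by
  choose i hi using fun x : {x : X // ‖x‖ ≤ 1} => hcov x x.2
  let σ (x : {x : X // ‖x‖ ≤ 1}) : {x : X // ‖x‖ ≤ 1} := ⟨(2 : ℝ) • (x.1 - c (i x)), by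
    rw [norm_smul, Real.norm_of_nonneg zero_le_two]
    linarith [hi x]⟩
  let w (x : {x : X // ‖x‖ ≤ 1}) (k : ℕ) : ι := i (σ^[k] x)
  intro x hx
  rw [mem_closedBall_zero_iff] at hx
  have hle (x : X) (w : ℕ → ι) (hx : ‖x‖ ≤ 1) : ‖x - codePoint (1 / 2) c w‖ ≤ 2 := by
    have := norm_codePoint_le (a := 1 / 2) (by norm_num) le_rfl hc w
    exact (norm_sub_le _ _).trans (by linarith)
  have key := nonpos_of_le_mul_of_bddAbove (α := {x : X // ‖x‖ ≤ 1})
    (e := fun x => ‖x.1 - codePoint (1 / 2) c (w x)‖) (θ := 1 / 2) (M := 2) (by norm_num)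
    (by norm_num) (fun x => hle x _ x.2) (fun x => Or.inr ⟨σ x, ?_⟩) ⟨x, hx⟩
  · exact ⟨_, (sub_eq_zero.1 (norm_le_zero_iff.1 key)).symm⟩
  · have h1 : (fun k => w x (k + 1)) = w (σ x) := by
      funext k
      simp only [w, Function.iterate_succ_apply]
    have h2 : x.1 = c (w x 0) + (1 / 2 : ℝ) • (σ x).1 := by
      simp [w, σ, smul_smul]
    have h3 := codePoint_eq (a := 1 / 2) (by norm_num) le_rfl hc (w x)
    rw [h1] at h3
    refine le_of_eq ?_
    nth_rewrite 1 [h2]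
    rw [h3, add_sub_add_left_eq_sub, ← smul_sub, norm_smul, Real.norm_of_nonneg (by norm_num)]

lemma CubeConfig.cantorMap_codePoint [Fintype ι] (C : CubeConfig X ι) (w : ℕ → ι) :
    C.cantorMap (codePoint C.a C.c w) = codePoint C.b C.c w := by
  have ha2 : C.a ≤ 1 / 2 := (C.a_lt.trans C.R_lt).le
  have hb2 : C.b ≤ 1 / 2 := C.b_lt_half.le
  have key := nonpos_of_le_mul_of_bddAbove
    (e := fun w => ‖C.cantorMap (codePoint C.a C.c w) - codePoint C.b C.c w‖) (θ := C.b) (M := 2)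
    C.b_pos.le (C.b_lt_half.trans one_half_lt_one) (fun w => ?_) (fun w => Or.inr ?_) w
  · exact sub_eq_zero.1 (norm_le_zero_iff.1 key)
  · have h1 := norm_codePoint_le C.a_pos.le ha2 C.norm_c_le w
    have h2 := norm_codePoint_le C.b_pos.le hb2 C.norm_c_le w
    exact (norm_sub_le _ _).trans (by linarith [C.norm_cantorMap_le_one h1])
  · refine ⟨fun k => w (k + 1), le_of_eq ?_⟩
    have h1 : codePoint C.a C.c w - C.c (w 0) = C.a • codePoint C.a C.c fun k => w (k + 1) := by
      rw [codePoint_eq C.a_pos.le ha2 C.norm_c_le w, add_sub_cancel_left]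
    have h2 : ‖codePoint C.a C.c w - C.c (w 0)‖ ≤ C.a := by
      rw [h1, norm_smul, Real.norm_of_nonneg C.a_pos.le]
      exact mul_le_of_le_one_right C.a_pos.le (norm_codePoint_le C.a_pos.le ha2 C.norm_c_le _)
    rw [C.cantorMap_of_mem h2, h1, inv_smul_smul₀ C.a_pos.ne',
      codePoint_eq C.b_pos.le hb2 C.norm_c_le w, add_sub_add_left_eq_sub, ← smul_sub, norm_smul,
      Real.norm_of_nonneg C.b_pos.le]

end Coding

lemma maxStretch_div_minStretch_le {X Y : Type*} [MetricSpace X] [MetricSpace Y] {Ω : Set X}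
    {f : X → Y} {x : X} {r K : ℝ} (hK : 0 ≤ K)
    (h : ∀ y ∈ Ω, ∀ z ∈ Ω, dist y x = r → dist z x = r → dist (f y) (f x) ≤ K * dist (f z) (f x)) :
    maxStretch Ω f x r / minStretch Ω f x r ≤ K := by
  rcases ({y ∈ Ω | dist y x = r}).eq_empty_or_nonempty with h0 | hne
  · simpa [maxStretch, minStretch, h0] using hK
  have hmin : 0 ≤ minStretch Ω f x r :=
    Real.sInf_nonneg (by rintro _ ⟨y, -, rfl⟩; exact dist_nonneg)
  refine div_le_of_le_mul₀ hmin hK (csSup_le (hne.image _) ?_)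
  rintro _ ⟨y, ⟨hyΩ, hy⟩, rfl⟩
  rcases hK.eq_or_lt with rfl | hK'
  · obtain ⟨z, hzΩ, hz⟩ := hne
    simpa using h y hyΩ z hzΩ hy hz
  rw [← div_le_iff₀' hK']
  refine le_csInf (hne.image _) ?_
  rintro _ ⟨z, ⟨hzΩ, hz⟩, rfl⟩
  rw [div_le_iff₀' hK']
  exact h y hyΩ z hzΩ hy hz

/-- A weakly quasisymmetric homeomorphism remains quasiconformal after conjugation by a linear
isomorphism. -/
lemma exists_isQCHomeoOn_conj {V X : Type*} [NormedAddCommGroup V] [NormedSpace ℝ V]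
    [NormedAddCommGroup X] [NormedSpace ℝ X] (e : V ≃L[ℝ] X) {f g : X → X}
    (hf : Continuous f) (hg : Continuous g) (hgf : Function.LeftInverse g f)
    (hfg : Function.RightInverse g f)
    (hqs : ∀ A : ℝ, 1 ≤ A → ∃ H : ℝ, 1 ≤ H ∧ ∀ x y z : X, ‖y - x‖ ≤ A * ‖z - x‖ →
      ‖f y - f x‖ ≤ H * ‖f z - f x‖) :
    ∃ K : ℝ, 1 ≤ K ∧ IsQCHomeoOn K (fun v => e.symm (f (e v))) univ univ := by
  set A₁ := ‖(e : V →L[ℝ] X)‖ + 1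
  set A₂ := ‖(e.symm : X →L[ℝ] V)‖ + 1
  have hA₁ : 1 ≤ A₁ := le_add_of_nonneg_left (norm_nonneg _)
  have hA₂ : 1 ≤ A₂ := le_add_of_nonneg_left (norm_nonneg _)
  have h₁ (u v : V) : ‖e u - e v‖ ≤ A₁ * ‖u - v‖ := by
    rw [← map_sub]
    exact ((e : V →L[ℝ] X).le_opNorm _).trans
      (mul_le_mul_of_nonneg_right (by simp [A₁]) (norm_nonneg _))
  have h₂ (x y : X) : ‖e.symm x - e.symm y‖ ≤ A₂ * ‖x - y‖ := by
    rw [← map_sub]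
    exact ((e.symm : X →L[ℝ] V).le_opNorm _).trans
      (mul_le_mul_of_nonneg_right (by simp [A₂]) (norm_nonneg _))
  obtain ⟨H, hH, hfH⟩ := hqs (A₁ * A₂) (one_le_mul_of_one_le_of_one_le hA₁ hA₂)
  have hinv : Function.LeftInverse (fun v => e.symm (g (e v))) fun v => e.symm (f (e v)) :=
    fun v => by simp [hgf (e v)]
  have hinv' : Function.RightInverse (fun v => e.symm (g (e v))) fun v => e.symm (f (e v)) :=
    fun v => by simp [hfg (e v)]
  refine ⟨A₂ * (H * A₁), ?_, ⟨?_, ?_, fun v => e.symm (g (e v)), ?_, ?_⟩, fun x _ => ?_⟩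
  · exact one_le_mul_of_one_le_of_one_le hA₂ (one_le_mul_of_one_le_of_one_le hH hA₁)
  · exact bijOn_univ.2 ⟨hinv.injective, hinv'.surjective⟩
  · exact (e.symm.continuous.comp (hf.comp e.continuous)).continuousOn
  · exact ⟨fun v _ => hinv v, fun v _ => hinv' v⟩
  · exact (e.symm.continuous.comp (hg.comp e.continuous)).continuousOn
  · refine limsup_le_of_le (isCoboundedUnder_le_of_le _ (x := 0) fun r => ?_)
      (Eventually.of_forall fun r => ?_)
    · refine div_nonneg (Real.sSup_nonneg ?_) (Real.sInf_nonneg ?_) <;>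
      · rintro _ ⟨y, -, rfl⟩
        exact dist_nonneg
    · refine maxStretch_div_minStretch_le (by positivity) fun y _ z _ hy hz => ?_
      rw [dist_eq_norm] at hy hz
      have h3 : ‖e y - e x‖ ≤ A₁ * A₂ * ‖e z - e x‖ := by
        have h4 := h₂ (e z) (e x)
        rw [e.symm_apply_apply, e.symm_apply_apply, hz, ← hy] at h4
        rw [mul_assoc]
        exact (h₁ y x).trans (mul_le_mul_of_nonneg_left h4 (by positivity))
      have h5 := h₁ (e.symm (f (e z))) (e.symm (f (e x)))
      rw [e.apply_symm_apply, e.apply_symm_apply] at h5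
      rw [dist_eq_norm, dist_eq_norm]
      calc _ ≤ A₂ * ‖f (e y) - f (e x)‖ := h₂ _ _
        _ ≤ A₂ * (H * ‖f (e z) - f (e x)‖) :=
          mul_le_mul_of_nonneg_left (hfH _ _ _ h3) (by positivity)
        _ ≤ A₂ * (H * (A₁ * ‖e.symm (f (e z)) - e.symm (f (e x))‖)) := by gcongr
        _ = _ := by ring

section Cube

variable {n : ℕ}

/-- The vertices of the cube `[-1/2, 1/2]ⁿ`. -/
def cubeVertex (ε : Fin n → Bool) (j : Fin n) : ℝ := if ε j then 1 / 2 else -(1 / 2)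

lemma norm_cubeVertex_le (ε : Fin n → Bool) : ‖cubeVertex ε‖ ≤ 1 / 2 := by
  refine (pi_norm_le_iff_of_nonneg (by norm_num)).2 fun j => ?_
  unfold cubeVertex
  split_ifs <;> norm_num

lemma one_le_norm_cubeVertex_sub (ε δ : Fin n → Bool) (h : ε ≠ δ) :
    1 ≤ ‖cubeVertex ε - cubeVertex δ‖ := by
  obtain ⟨j, hj⟩ := Function.ne_iff.1 h
  refine le_trans ?_ (norm_le_pi_norm (cubeVertex ε - cubeVertex δ) j)
  rw [Pi.sub_apply, cubeVertex, cubeVertex]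
  cases h1 : ε j <;> cases h2 : δ j <;> simp_all <;> norm_num

lemma exists_norm_sub_cubeVertex_le {x : Fin n → ℝ} (hx : ‖x‖ ≤ 1) :
    ∃ ε, ‖x - cubeVertex ε‖ ≤ 1 / 2 := by
  refine ⟨fun j => decide (0 ≤ x j), (pi_norm_le_iff_of_nonneg (by norm_num)).2 fun j => ?_⟩
  have h := abs_le.1 ((norm_le_pi_norm x j).trans hx)
  rw [Pi.sub_apply, cubeVertex, Real.norm_eq_abs, abs_le]
  by_cases h0 : 0 ≤ x j
  · simp only [h0, decide_true, if_true]
    constructor <;> linarith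
  · simp only [h0, decide_false]
    push Not at h0
    constructor <;> simp <;> linarith

lemma half_rpow_lt_half {s : ℝ} (hs : 0 < s) (hsn : s < n) : (1 / 2 : ℝ) ^ (n / s) < 1 / 2 := by
  have h1 : 1 < n / s := (one_lt_div hs).2 hsn
  simpa using Real.rpow_lt_rpow_of_exponent_gt (by norm_num : (0 : ℝ) < 1 / 2) (by norm_num) h1

/-- The Cantor set generated by the `2ⁿ` corner cubes with ratio `2 ^ (-n / s)` has
dimension `s`. -/
lemma dimH_range_codePoint_cubeVertex {s : ℝ} (hs : 0 < s) (hsn : s < n) :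
    dimH (range (codePoint ((1 / 2 : ℝ) ^ (n / s)) (cubeVertex (n := n)))) = ENNReal.ofReal s := by
  set a : ℝ := (1 / 2 : ℝ) ^ (n / s) with haeq
  have ha : 0 < a := by positivity
  have ha2 : a < 1 / 2 := half_rpow_lt_half hs hsn
  have hn : (0 : ℝ) < n := hs.trans hsn
  apply le_antisymm
  · have := dimH_range_codePoint_le (c := cubeVertex (n := n)) (s := s.toNNReal) ha ha2.le
      norm_cubeVertex_le (by
        rw [Real.coe_toNNReal _ hs.le, haeq, ← Real.rpow_mul (by norm_num),
          div_mul_cancel₀ _ hs.ne', Real.rpow_natCast, Fintype.card_fun, Fintype.card_fin,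
          Fintype.card_bool]
        push_cast
        rw [← mul_pow]
        norm_num)
    simpa [ENNReal.ofReal] using this
  · have hα : 0 < (s / n).toNNReal := Real.toNNReal_pos.2 (by positivity)
    have h1 := dimH_range_codePoint_half_le (c := cubeVertex (n := n)) ha ha2 norm_cubeVertex_le
      one_le_norm_cubeVertex_sub hα (by
        rw [Real.coe_toNNReal _ (by positivity), haeq, ← Real.rpow_mul (by norm_num),
          div_mul_div_cancel₀ hs.ne', div_self hn.ne', Real.rpow_one])
    have h2 := dimH_mono (ball_subset_closedBall.trans (closedBall_subset_range_codePoint_half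
      (norm_cubeVertex_le (n := n)) fun x => exists_norm_sub_cubeVertex_le))
    rw [Real.dimH_ball_pi_fin _ one_pos] at h2
    have h3 := h2.trans h1
    rw [ENNReal.le_div_iff_mul_le (by simp [hα.ne']) (by simp)] at h3
    refine le_trans (le_of_eq ?_) h3
    change _ = (n : ℝ≥0∞) * ENNReal.ofReal (s / n)
    rw [← ENNReal.ofReal_natCast, ← ENNReal.ofReal_mul hn.le, mul_div_cancel₀ _ hn.ne']

end Cube

/-- Sharpness (Gehring–Väisälä): for any `0 < s, s' < n` there are compact sets
`E, E' ⊆ ℝ^n` with `dimH E = s`, `dimH E' = s'` and a quasiconformal homeomorphism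
`f : ℝ^n → ℝ^n` with `f(E) = E'`. -/
theorem qc_dim_sharpness (n : ℕ) (hn : 2 ≤ n) (s s' : ℝ)
    (hs0 : 0 < s) (hsn : s < n) (hs'0 : 0 < s') (hs'n : s' < n) :
    ∃ E E' : Set (EuclideanSpace ℝ (Fin n)), IsCompact E ∧ IsCompact E' ∧
      dimH E = ENNReal.ofReal s ∧ dimH E' = ENNReal.ofReal s' ∧
      ∃ (f : EuclideanSpace ℝ (Fin n) → EuclideanSpace ℝ (Fin n)) (K : ℝ),
        1 ≤ K ∧ IsQCHomeoOn K f Set.univ Set.univ ∧ f '' E = E' := by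
  have ha := half_rpow_lt_half hs0 hsn
  have hb := half_rpow_lt_half hs'0 hs'n
  obtain ⟨R, hR, hR2⟩ := exists_between (max_lt ha hb)
  let C : CubeConfig (Fin n → ℝ) (Fin n → Bool) :=
    { c := cubeVertex
      a := (1 / 2 : ℝ) ^ (n / s)
      b := (1 / 2 : ℝ) ^ (n / s')
      R := R
      p := fun _ => 1
      a_pos := by positivity
      b_pos := by positivity
      a_lt := (le_max_left _ _).trans_lt hR
      b_lt := (le_max_right _ _).trans_lt hR
      R_lt := hR2
      norm_c_le := norm_cubeVertex_le
      one_le_sep := one_le_norm_cubeVertex_sub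
      one_le_norm_p := by
        simpa using norm_le_pi_norm (fun _ : Fin n => (1 : ℝ)) ⟨0, by omega⟩ }
  let e : EuclideanSpace ℝ (Fin n) ≃L[ℝ] (Fin n → ℝ) := EuclideanSpace.equiv (Fin n) ℝ
  obtain ⟨K, hK, hqc⟩ := exists_isQCHomeoOn_conj e
    C.uniformContinuous_cantorMap.continuous C.swap.uniformContinuous_cantorMap.continuous
    C.cantorMap_swap_cantorMap C.swap.cantorMap_swap_cantorMap
    fun A hA => C.exists_weak_quasisymmetry hA
  have hcpt {r : ℝ} (hr0 : 0 < r) (hrn : r < n) :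
      IsCompact (e.symm '' range (codePoint ((1 / 2 : ℝ) ^ (n / r)) (cubeVertex (n := n)))) :=
    (isCompact_range (continuous_codePoint (by positivity) (half_rpow_lt_half hr0 hrn).le
      norm_cubeVertex_le)).image e.symm.continuous
  refine ⟨_, _, hcpt hs0 hsn, hcpt hs'0 hs'n, ?_, ?_, _, K, hK, hqc, ?_⟩
  · rw [ContinuousLinearEquiv.dimH_image, dimH_range_codePoint_cubeVertex hs0 hsn]
  · rw [ContinuousLinearEquiv.dimH_image, dimH_range_codePoint_cubeVertex hs'0 hs'n]
  · rw [← range_comp, ← range_comp, ← range_comp]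
    congr 1
    funext w
    simp only [Function.comp_apply, e.apply_symm_apply]
    exact congrArg e.symm (C.cantorMap_codePoint w)
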